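/- For all integers k ≥ 1 and n with n > 2(k+1), one has a(k) < o(n). (This expresses that the number of nilpotent orbits in a Lie algebra of type A_k is smaller than the number of nilpotent orbits in any classical simple Lie algebra admitting a self-dual module of dimension n > 2(k+1).) -/

import Mathlib

/-- The number of partitions of `n`: multisets of positive integers with sum `n`. -/
noncomputable def numPartitions (n : ℕ) : ℕ :=
  Nat.card {l : Multiset ℕ // (∀ i ∈ l, 0 < i) ∧ l.sum = n}

/-- `a n` is the number of partitions of `n + 1`, i.e. the number of nilpotent
adjoint orbits in the simple complex Lie algebra of type `A_n`. -/
noncomputable def a (n : ℕ) : ℕ := numPartitions (n + 1)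

/-- `b m` is the number of pairs `(λ, μ)` of partitions with `2|λ| + |μ| = 2m + 1`
where the parts of `μ` are pairwise distinct and all odd; this is the number of
nilpotent adjoint orbits in type `B_m`. -/
noncomputable def b (m : ℕ) : ℕ :=
  Nat.card {p : Multiset ℕ × Multiset ℕ //
    (∀ i ∈ p.1, 0 < i) ∧ (∀ i ∈ p.2, 0 < i) ∧ p.2.Nodup ∧ (∀ i ∈ p.2, Odd i) ∧
    2 * p.1.sum + p.2.sum = 2 * m + 1}

/-- `c m` is the number of pairs `(λ, μ)` of partitions with `|λ| + |μ| = m`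
where the parts of `μ` are pairwise distinct; this is the number of
nilpotent adjoint orbits in type `C_m`. -/
noncomputable def c (m : ℕ) : ℕ :=
  Nat.card {p : Multiset ℕ × Multiset ℕ //
    (∀ i ∈ p.1, 0 < i) ∧ (∀ i ∈ p.2, 0 < i) ∧ p.2.Nodup ∧
    p.1.sum + p.2.sum = m}

/-- `d m` is the number of pairs `(λ, μ)` of partitions with `2|λ| + |μ| = 2m`
where the parts of `μ` are pairwise distinct and all odd; this is the number of
nilpotent adjoint orbits in type `D_m`. -/
noncomputable def d (m : ℕ) : ℕ :=
  Nat.card {p : Multiset ℕ × Multiset ℕ //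
    (∀ i ∈ p.1, 0 < i) ∧ (∀ i ∈ p.2, 0 < i) ∧ p.2.Nodup ∧ (∀ i ∈ p.2, Odd i) ∧
    2 * p.1.sum + p.2.sum = 2 * m}

/-- `o n` is the lower bound for the number of nilpotent adjoint orbits in a
classical simple Lie algebra having an (irreducible, self-dual as appropriate)
module of dimension `n`. -/
noncomputable def o (n : ℕ) : ℕ :=
  if Odd n then min (a (n - 1)) (b ((n - 1) / 2))
  else min (a (n - 1)) (min (c (n / 2)) (d (n / 2)))

/-- There are finitely many multisets of positive integers with bounded sum. -/
theorem finite_multiset_pos_sum_le (M : ℕ) :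
    {l : Multiset ℕ | (∀ i ∈ l, 0 < i) ∧ l.sum ≤ M}.Finite := by
  refine ((Set.finite_Iic M).biUnion
    fun n _ => Set.finite_range (Nat.Partition.parts (n := n))).subset ?_
  rintro l ⟨hpos, hsum⟩
  exact Set.mem_biUnion (Set.mem_Iic.2 hsum) ⟨⟨l, fun {i} hi => hpos i hi, rfl⟩, rfl⟩

/-- An injection from the partitions of `N` into a finite family that misses a member of the
family shows that the family has more than `numPartitions N` members. -/
theorem numPartitions_lt_card {β : Type*} {P : β → Prop} (hfin : {x | P x}.Finite) (N : ℕ)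
    {f : Multiset ℕ → β} (hf : Function.Injective f)
    (hP : ∀ l : Multiset ℕ, (∀ i ∈ l, 0 < i) → l.sum = N → P (f l))
    {x : β} (hx : P x) (hne : ∀ l : Multiset ℕ, l.sum = N → f l ≠ x) :
    numPartitions N < Nat.card {x // P x} := by
  have hlt : (f '' {l | (∀ i ∈ l, 0 < i) ∧ l.sum = N}).ncard < {x | P x}.ncard := by
    refine Set.ncard_lt_ncard ((Set.ssubset_iff_of_subset ?_).2 ⟨x, hx, ?_⟩) hfin
    · rintro _ ⟨l, ⟨hpos, hsum⟩, rfl⟩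
      exact hP l hpos hsum
    · rintro ⟨l, ⟨-, hsum⟩, h⟩
      exact hne l hsum h
  rwa [Set.ncard_image_of_injective _ hf] at hlt

/-- Adding parts equal to `1` preserves positivity of the parts. -/
theorem pos_of_mem_add_replicate_one {l : Multiset ℕ} (hl : ∀ i ∈ l, 0 < i) (r : ℕ) :
    ∀ i ∈ l + Multiset.replicate r 1, 0 < i := by
  intro i hi
  rcases Multiset.mem_add.1 hi with h | h
  · exact hl i h
  · rw [Multiset.eq_of_mem_replicate h]
    exact one_pos

theorem numPartitions_strict_lt {N n : ℕ} (hN : 1 ≤ N) (hn : N < n) :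
    numPartitions N < numPartitions n := by
  refine numPartitions_lt_card (f := fun l => l + Multiset.replicate (n - N) 1) (x := {n})
    ((finite_multiset_pos_sum_le n).subset fun l hl => ⟨hl.1, hl.2.le⟩) N
    (add_left_injective _) ?_ ?_ ?_
  · intro l hpos hsum
    exact ⟨pos_of_mem_add_replicate_one hpos _, by simp [hsum]; omega⟩
  · simp; omega
  · intro l _ h
    have hmem : 1 ∈ l + Multiset.replicate (n - N) 1 :=
      Multiset.mem_add.2 (Or.inr (Multiset.mem_replicate.2 ⟨by omega, rfl⟩))
    rw [h, Multiset.mem_singleton] at hmem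
    omega

/-- A family of pairs of multisets of positive integers with bounded sums is finite. -/
theorem finite_pairs_of_sum_le {P : Multiset ℕ × Multiset ℕ → Prop} (M : ℕ)
    (h : ∀ p, P p → (∀ i ∈ p.1, 0 < i) ∧ (∀ i ∈ p.2, 0 < i) ∧ p.1.sum ≤ M ∧ p.2.sum ≤ M) :
    {p | P p}.Finite := by
  refine ((finite_multiset_pos_sum_le M).prod (finite_multiset_pos_sum_le M)).subset ?_
  intro p hp
  obtain ⟨h1, h2, h3, h4⟩ := h p hp
  exact ⟨⟨h1, h3⟩, ⟨h2, h4⟩⟩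

theorem injective_add_replicate_pair (r : ℕ) (μ : Multiset ℕ) :
    Function.Injective fun l : Multiset ℕ => (l + Multiset.replicate r 1, μ) :=
  fun _ _ h => add_left_injective _ (Prod.ext_iff.1 h).1

theorem numPartitions_lt_b {N m : ℕ} (hN : 1 ≤ N) (hm : N ≤ m) : numPartitions N < b m := by
  refine numPartitions_lt_card (f := fun l => (l + Multiset.replicate (m - N) 1, {1}))
    (x := (0, {2 * m + 1})) (finite_pairs_of_sum_le (2 * m + 1) ?_) N
    (injective_add_replicate_pair _ _) ?_ ?_ ?_
  · rintro p ⟨h1, h2, -, -, h⟩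
    exact ⟨h1, h2, by omega, by omega⟩
  · intro l hpos hsum
    exact ⟨pos_of_mem_add_replicate_one hpos _, by simp, by simp, by simp, by simp [hsum]; omega⟩
  · simp
  · intro l _ h
    have := Multiset.singleton_inj.1 (Prod.ext_iff.1 h).2
    omega

theorem numPartitions_lt_c {N m : ℕ} (hN : 1 ≤ N) (hm : N ≤ m) : numPartitions N < c m := by
  refine numPartitions_lt_card (f := fun l => (l + Multiset.replicate (m - N) 1, 0))
    (x := (0, {m})) (finite_pairs_of_sum_le m ?_) N
    (injective_add_replicate_pair _ _) ?_ ?_ ?_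
  · rintro p ⟨h1, h2, -, h⟩
    exact ⟨h1, h2, by omega, by omega⟩
  · intro l hpos hsum
    exact ⟨pos_of_mem_add_replicate_one hpos _, by simp, by simp, by simp [hsum]; omega⟩
  · simp; omega
  · intro l _ h
    exact Multiset.singleton_ne_zero _ (Prod.ext_iff.1 h).2.symm

theorem numPartitions_lt_d {N m : ℕ} (hm : N ≤ m) (hm2 : 2 ≤ m) : numPartitions N < d m := by
  refine numPartitions_lt_card (f := fun l => (l + Multiset.replicate (m - N) 1, 0))
    (x := (0, {1, 2 * m - 1})) (finite_pairs_of_sum_le (2 * m) ?_) N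
    (injective_add_replicate_pair _ _) ?_ ?_ ?_
  · rintro p ⟨h1, h2, -, -, h⟩
    exact ⟨h1, h2, by omega, by omega⟩
  · intro l hpos hsum
    exact ⟨pos_of_mem_add_replicate_one hpos _, by simp, by simp, by simp, by simp [hsum]; omega⟩
  · have hodd : Odd (2 * m - 1) := ⟨m - 1, by omega⟩
    refine ⟨by simp, ?_, ?_, ?_, ?_⟩
    · simp; omega
    · simp; omega
    · simp [hodd]
    · simp; omega
  · intro l _ h
    have := congrArg Multiset.card (Prod.ext_iff.1 h).2
    simp at this

theorem stmt_6 : ∀ k n : ℕ, 1 ≤ k → 2 * (k + 1) < n → a k < o n := by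
  intro k n hk hn
  have ha : a k < a (n - 1) := numPartitions_strict_lt (by omega) (by omega)
  unfold o
  split_ifs with hodd
  · exact lt_min ha (numPartitions_lt_b (by omega) (by omega))
  · exact lt_min ha (lt_min (numPartitions_lt_c (by omega) (by omega))
      (numPartitions_lt_d (by omega) (by omega)))
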